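/- Let R be a local ring with maximal ideal P, F a finitely generated R-module, and U a pure submodule of F. Then μ(F/U) = μ(F) − μ(U), where μ denotes the minimal number of generators. -/

import Mathlib

open IsLocalRing

universe u

/-- A chain (valuation) ring: ideals are totally ordered by inclusion. -/
def IsChainRing (R : Type u) [CommRing R] : Prop := ∀ I J : Ideal R, I ≤ J ∨ J ≤ I

/-- Archimedean: the maximal ideal is the only nonzero prime ideal. -/
def IsArchimedeanLocal (R : Type u) [CommRing R] [IsLocalRing R] : Prop :=
  ∀ Q : Ideal R, Q.IsPrime → Q ≠ ⊥ → Q = maximalIdeal R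

/-- The annihilator ideal `(0 : x)` of a module element. -/
def annOf (R : Type u) {M : Type u} [CommRing R] [AddCommGroup M] [Module R M] (x : M) :
    Ideal R := LinearMap.ker (LinearMap.toSpanSingleton R M x)

/-- fp-injective (absolutely pure): every homomorphism from a finitely generated
submodule of a finite free module extends; equivalently `Ext¹(F, M) = 0` for every
finitely presented `F`. -/
def IsFpInjective (R M : Type u) [CommRing R] [AddCommGroup M] [Module R M] : Prop :=
  ∀ (n : ℕ) (K : Submodule R (Fin n → R)), K.FG →
    ∀ g : K →ₗ[R] M, ∃ h : (Fin n → R) →ₗ[R] M, ∀ x : K, h x = g x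

/-- A coherent ring: every finitely generated ideal is finitely presented. -/
def IsCoherentRing (R : Type u) [CommRing R] : Prop :=
  ∀ I : Ideal R, I.FG → Module.FinitePresentation R ↥I

/-- An IF-ring: coherent and self fp-injective. -/
def IsIFRing (R : Type u) [CommRing R] : Prop := IsCoherentRing R ∧ IsFpInjective R R

/-- Purity of a submodule: `I·M ⊓ X = I·X` for every finitely generated ideal `I`. -/
def IsPureSubmodule {R M : Type u} [CommRing R] [AddCommGroup M] [Module R M]
    (X : Submodule R M) : Prop :=
  ∀ I : Ideal R, I.FG → (I • (⊤ : Submodule R M)) ⊓ X = I • X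

/-- A submodule is uniserial if its submodules are totally ordered by inclusion. -/
def IsUniserialSub {R M : Type u} [CommRing R] [AddCommGroup M] [Module R M]
    (U : Submodule R M) : Prop :=
  ∀ V W : Submodule R M, V ≤ U → W ≤ U → V ≤ W ∨ W ≤ V

/-- A uniserial module: submodules are totally ordered by inclusion. -/
def IsUniserialMod (R M : Type u) [CommRing R] [AddCommGroup M] [Module R M] : Prop :=
  ∀ V W : Submodule R M, V ≤ W ∨ W ≤ V

/-- A faithful submodule: only `0` annihilates all its elements. -/
def IsFaithfulSub {R M : Type u} [CommRing R] [AddCommGroup M] [Module R M]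
    (U : Submodule R M) : Prop := ∀ r : R, (∀ x ∈ U, r • x = 0) → r = 0

/-- A faithful module: its annihilator is zero. -/
def IsFaithfulMod (R M : Type u) [CommRing R] [AddCommGroup M] [Module R M] : Prop :=
  ∀ r : R, (∀ x : M, r • x = 0) → r = 0

/-- `μ(M)`: the minimal number of generators of a module. -/
noncomputable def mu (R M : Type u) [CommRing R] [AddCommGroup M] [Module R M] : ℕ :=
  sInf {n : ℕ | ∃ s : Finset M, s.card = n ∧ Submodule.span R (s : Set M) = ⊤}

/-- A maximal ring: every family of cosets of ideals with the finite intersection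
property has nonempty total intersection. -/
def IsMaximalRing (R : Type u) [CommRing R] : Prop :=
  ∀ (ι : Type u) (a : ι → R) (A : ι → Ideal R),
    (∀ s : Finset ι, ∃ x : R, ∀ i ∈ s, x - a i ∈ A i) → ∃ x : R, ∀ i, x - a i ∈ A i

/-- Almost maximal: `R/A` is maximal for every nonzero ideal `A`. -/
def IsAlmostMaximalRing (R : Type u) [CommRing R] : Prop :=
  ∀ A : Ideal R, A ≠ ⊥ → IsMaximalRing (R ⧸ A)

/-- A uniform module: any two nonzero submodules intersect nontrivially. -/
def IsUniformMod (R M : Type u) [CommRing R] [AddCommGroup M] [Module R M] : Prop :=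
  ∀ N₁ N₂ : Submodule R M, N₁ ≠ ⊥ → N₂ ≠ ⊥ → N₁ ⊓ N₂ ≠ ⊥

/-- Bounded module type with bound `n`: every finitely generated module is a direct
sum of submodules each generated by at most `n` elements. -/
def HasBoundedModuleType (R : Type u) [CommRing R] (n : ℕ) : Prop :=
  ∀ (M : Type u) [AddCommGroup M] [Module R M], Module.Finite R M →
    ∃ (ι : Type u) (N : ι → Submodule R M),
      iSupIndep N ∧ (⨆ i, N i) = ⊤ ∧
      ∀ i, ∃ s : Finset M, s.card ≤ n ∧ Submodule.span R (s : Set M) = N i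

/-- The determinant obtained from the columns `i, J 0, …, J (k - 1)` of the `(k + 1)`-rowed matrix
`h`, with the scalar entries of the first column replaced by the combinations `∑ i, h a i • x i`. -/
def bordered {R M ι : Type*} [CommRing R] [AddCommGroup M] [Module R M] [Fintype ι]
    (x : ι → M) {k : ℕ} (h : Fin (k + 1) → ι → R) (J : Fin k → ι) : M :=
  ∑ i, (Matrix.of fun a b => h a ((Fin.cons i J : Fin (k + 1) → ι) b)).det • x i

section Bordered

variable {R M ι : Type*} [CommRing R] [AddCommGroup M] [Module R M] [Fintype ι]

theorem bordered_zero (x : ι → M) (h : Fin 1 → ι → R) (J : Fin 0 → ι) :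
    bordered x h J = ∑ i, h 0 i • x i := by
  simp [bordered]

/-- Expansion of a bordered determinant along its first row. -/
theorem bordered_cons (x : ι → M) {k : ℕ} (c : ι → R) (h : Fin (k + 1) → ι → R)
    (J : Fin (k + 1) → ι) :
    bordered x (Fin.cons c h : Fin (k + 2) → ι → R) J =
      (Matrix.of fun a b => h a (J b)).det • ∑ i, c i • x i +
        ∑ b : Fin (k + 1), ((-1) ^ ((b : ℕ) + 1) * c (J b)) •
          bordered x h (fun d => J (b.succAbove d)) := by
  have key : ∀ (i : ι) (b : Fin (k + 1)),
      (Matrix.of fun a e => (Fin.cons c h : Fin (k + 2) → ι → R) a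
        ((Fin.cons i J : Fin (k + 2) → ι) e)).submatrix Fin.succ b.succ.succAbove =
      Matrix.of fun a e => h a
        ((Fin.cons i (fun d => J (b.succAbove d)) : Fin (k + 1) → ι) e) := by
    intro i b
    ext a e
    refine Fin.cases ?_ (fun d => ?_) e <;> simp
  have key0 : ∀ i : ι,
      (Matrix.of fun a e => (Fin.cons c h : Fin (k + 2) → ι → R) a
        ((Fin.cons i J : Fin (k + 2) → ι) e)).submatrix Fin.succ (Fin.succAbove 0) =
      Matrix.of fun a e => h a (J e) := by
    intro i
    ext a e
    simp
  simp only [bordered, Finset.smul_sum]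
  rw [Finset.sum_comm, ← Finset.sum_add_distrib]
  refine Finset.sum_congr rfl fun i _ => ?_
  rw [Matrix.det_succ_row_zero, Fin.sum_univ_succ, key0, add_smul, Finset.sum_smul]
  congr 1
  · simp [smul_smul, mul_comm]
  · refine Finset.sum_congr rfl fun b _ => ?_
    rw [key, smul_smul]
    simp

theorem bordered_mem (x : ι → M) (U : Submodule R M) {k : ℕ} (h : Fin (k + 1) → ι → R)
    (hU : ∀ a, ∑ i, h a i • x i ∈ U) (J : Fin k → ι) : bordered x h J ∈ U := by
  induction k with
  | zero => rw [bordered_zero]; exact hU 0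
  | succ k ih =>
    rw [← Fin.cons_self_tail h, bordered_cons]
    exact U.add_mem (U.smul_mem _ (hU 0))
      (U.sum_mem fun b _ => U.smul_mem _ (ih _ (fun a => hU a.succ) _))

theorem bordered_eq_zero_of_card_le (x : ι → M) {k : ℕ} (hk : Fintype.card ι ≤ k)
    (h : Fin (k + 1) → ι → R) (J : Fin k → ι) : bordered x h J = 0 := by
  refine Finset.sum_eq_zero fun i _ => ?_
  obtain ⟨a, b, hab, he⟩ := Fintype.exists_ne_map_eq_of_card_lt
    (Fin.cons i J : Fin (k + 1) → ι) (by simpa using Nat.lt_succ_of_le hk)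
  rw [Matrix.det_zero_of_column_eq hab (fun c => by simp [he]), zero_smul]

end Bordered

section Pure

variable {R F : Type u} [CommRing R] [AddCommGroup F] [Module R F]

theorem IsPureSubmodule.smul_top_inf_le {U : Submodule R F} (hU : IsPureSubmodule U)
    (I : Ideal R) : (I • (⊤ : Submodule R F)) ⊓ U ≤ I • U := by
  rintro u ⟨hu, huU⟩
  obtain ⟨J, hJI, hJ, hu⟩ : ∃ J ≤ I, J.FG ∧ u ∈ J • (⊤ : Submodule R F) := by
    refine Submodule.smul_induction_on hu (fun r hr f _ => ?_) ?_
    · exact ⟨Ideal.span {r}, by simpa [Ideal.span_le] using hr, ⟨{r}, by simp⟩,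
        Submodule.smul_mem_smul (Ideal.mem_span_singleton_self r) trivial⟩
    · rintro y z ⟨J, hJI, hJ, hy⟩ ⟨K, hKI, hK, hz⟩
      exact ⟨J ⊔ K, sup_le hJI hKI, Submodule.FG.sup hJ hK, add_mem
        (Submodule.smul_mono_left le_sup_left hy) (Submodule.smul_mono_left le_sup_right hz)⟩
  exact Submodule.smul_mono_left hJI ((hU J hJ).le ⟨hu, huU⟩)

theorem IsPureSubmodule.map_mkQ {U V : Submodule R F} (hU : IsPureSubmodule U) (hVU : V ≤ U) :
    IsPureSubmodule (U.map V.mkQ) := by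
  intro I hI
  refine le_antisymm ?_ (le_inf (smul_mono_right _ le_top) Submodule.smul_le_right)
  rintro _ ⟨hz, u, hu, rfl⟩
  rw [← V.range_mkQ, ← Submodule.map_top, ← Submodule.map_smul''] at hz
  obtain ⟨f, hf, hfu⟩ := hz
  have hfu' : f - u ∈ V := by
    rwa [← V.ker_mkQ, LinearMap.sub_mem_ker_iff]
  have hfU : f ∈ U := by
    simpa using U.add_mem (hVU hfu') hu
  rw [← hfu, ← Submodule.map_smul'']
  exact Submodule.mem_map_of_mem ((hU I hI).le ⟨hf, hfU⟩)

variable [IsLocalRing R]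

theorem IsPureSubmodule.eq_bot_of_le_maximalIdeal_smul [Module.Finite R F] {U : Submodule R F}
    (hU : IsPureSubmodule U) (hle : U ≤ maximalIdeal R • (⊤ : Submodule R F)) : U = ⊥ := by
  obtain ⟨n, x, hx⟩ := Module.Finite.exists_fin (R := R) (M := F)
  have hcoeff : ∀ v ∈ U, ∃ c : Fin n → R, (∀ i, c i ∈ maximalIdeal R) ∧ ∑ i, c i • x i = v := by
    intro v hv
    have hv' := hle hv
    rw [← hx, Submodule.mem_ideal_smul_span_iff_exists_sum] at hv'
    obtain ⟨c, hc, rfl⟩ := hv'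
    exact ⟨c, hc, (Finsupp.sum_fintype c (fun i a => a • x i) fun i => zero_smul R (x i)).symm⟩
  have vanish : ∀ m k : ℕ, n ≤ k + m → ∀ h : Fin (k + 1) → Fin n → R,
      (∀ a, ∑ i, h a i • x i ∈ U) → ∀ J : Fin k → Fin n, bordered x h J = 0 := by
    intro m
    induction m with
    | zero =>
      intro k hk h _ J
      exact bordered_eq_zero_of_card_le x (by simpa using hk) h J
    | succ m ih =>
      intro k hk h hh J
      let W : Submodule R F := Submodule.span R (Set.range (bordered x h))
      suffices hW : W = ⊥ by
        have : bordered x h J ∈ W := Submodule.subset_span ⟨J, rfl⟩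
        rwa [hW, Submodule.mem_bot] at this
      refine Submodule.eq_bot_of_le_smul_of_le_jacobson_bot (maximalIdeal R) W
        (Submodule.fg_span (Set.finite_range _)) ?_ (maximalIdeal_le_jacobson ⊥)
      rw [Submodule.span_le]
      rintro _ ⟨J, rfl⟩
      let D : Fin n → R := fun i =>
        (Matrix.of fun a b => h a ((Fin.cons i J : Fin (k + 1) → Fin n) b)).det
      have hD : bordered x h J ∈ Ideal.span (Set.range D) • (⊤ : Submodule R F) :=
        Submodule.sum_mem _ fun i _ =>
          Submodule.smul_mem_smul (Ideal.subset_span ⟨i, rfl⟩) trivial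
      have hDU := hU.smul_top_inf_le _ ⟨hD, bordered_mem x U h hh J⟩
      refine (Submodule.smul_le (P := maximalIdeal R • W)).2 (fun r hr v hv => ?_) hDU
      suffices Ideal.span (Set.range D) ≤
          (maximalIdeal R • W).comap (LinearMap.toSpanSingleton R F v) from this hr
      rw [Ideal.span_le]
      rintro _ ⟨l, rfl⟩
      obtain ⟨c, hc, hcv⟩ := hcoeff v hv
      have h0 := ih (k + 1) (by omega) (Fin.cons c h : Fin (k + 2) → Fin n → R)
        (Fin.cases (by simpa [hcv] using hv) (by simpa using hh)) (Fin.cons l J)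
      rw [bordered_cons, hcv] at h0
      change D l • v ∈ maximalIdeal R • W
      rw [eq_neg_of_add_eq_zero_left h0]
      exact Submodule.neg_mem _ (Submodule.sum_mem _ fun b _ => Submodule.smul_mem_smul
        (Ideal.mul_mem_left _ _ (hc _)) (Submodule.subset_span ⟨_, rfl⟩))
  rw [Submodule.eq_bot_iff]
  intro u hu
  obtain ⟨c, -, rfl⟩ := hcoeff u hu
  simpa [bordered_zero] using
    vanish n 0 (by omega) (fun _ => c) (fun _ => hu) Fin.elim0

theorem IsPureSubmodule.fg [Module.Finite R F] {U : Submodule R F} (hU : IsPureSubmodule U) :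
    U.FG := by
  let P := maximalIdeal R
  obtain ⟨V, hVU, hV, hUV⟩ : ∃ V ≤ U, V.FG ∧ U ≤ V ⊔ P • (⊤ : Submodule R F) := by
    let : Field (R ⧸ P) := Ideal.Quotient.field P
    have : Module.Finite (R ⧸ P) (F ⧸ P • (⊤ : Submodule R F)) :=
      Module.Finite.of_restrictScalars_finite R _ _
    let l : (F ⧸ P • (⊤ : Submodule R F)) →ₛₗ[algebraMap R (R ⧸ P)]
        (F ⧸ P • (⊤ : Submodule R F)) :=
      { toFun := id
        map_add' := fun _ _ => rfl
        map_smul' := fun r x => (algebraMap_smul (R ⧸ P) r x).symm }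
    have : RingHomSurjective (algebraMap R (R ⧸ P)) := ⟨Ideal.Quotient.mk_surjective⟩
    have : IsNoetherian R (F ⧸ P • (⊤ : Submodule R F)) :=
      (l.isNoetherian_iff_of_bijective Function.bijective_id).2 inferInstance
    obtain ⟨t, hspan⟩ :=
      (IsNoetherian.noetherian (U.map (P • (⊤ : Submodule R F)).mkQ))
    classical
    obtain ⟨s, hsU, rfl⟩ := Finset.subset_set_image_iff.1
      (Submodule.subset_span.trans hspan.le : (t : Set _) ⊆ (P • (⊤ : Submodule R F)).mkQ '' U)
    refine ⟨Submodule.span R s, Submodule.span_le.2 hsU, ⟨s, rfl⟩, ?_⟩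
    rw [Finset.coe_image, ← Submodule.map_span] at hspan
    have := U.le_comap_map (P • (⊤ : Submodule R F)).mkQ
    rwa [← hspan, Submodule.comap_map_mkQ, sup_comm] at this
  have hbot := (hU.map_mkQ hVU).eq_bot_of_le_maximalIdeal_smul (by
    rw [← V.range_mkQ, ← Submodule.map_top, ← Submodule.map_smul'']
    refine (Submodule.map_mono hUV).trans ?_
    rw [Submodule.map_sup, Submodule.mkQ_map_self, bot_sup_eq])
  rw [← le_bot_iff, Submodule.map_le_iff_le_comap, ← LinearMap.ker, Submodule.ker_mkQ] at hbot
  rwa [le_antisymm hbot hVU]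

end Pure

theorem mu_eq_spanFinrank (R M : Type u) [CommRing R] [AddCommGroup M] [Module R M] :
    mu R M = (⊤ : Submodule R M).spanFinrank := by
  rw [Submodule.spanFinrank_eq_iInf, mu, iInf]
  congr 1
  ext n
  simp [and_comm]

theorem mu_eq_finrank (R M : Type u) [CommRing R] [IsLocalRing R] [AddCommGroup M] [Module R M]
    [Module.Finite R M] :
    mu R M = Module.finrank (ResidueField R) (TensorProduct R (ResidueField R) M) := by
  rw [mu_eq_spanFinrank,
    ← TensorProduct.spanFinrank_top_eq_of_residueField _ Module.Finite.fg_top,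
    ← Module.finrank_eq_spanFinrank_of_free]
  exact (Submodule.topEquiv.baseChange R (ResidueField R) _ _).finrank_eq

theorem stmt8 (R : Type u) [CommRing R] [IsLocalRing R]
    (F : Type u) [AddCommGroup F] [Module R F] (hF : Module.Finite R F)
    (U : Submodule R F) (hU : IsPureSubmodule U) :
    mu R (F ⧸ U) = mu R F - mu R ↥U := by
  have hfin : Module.Finite R U := Module.Finite.iff_fg.mpr hU.fg
  let K := ResidueField R
  have hinj : Function.Injective (U.subtype.baseChange K) := by
    rw [injective_iff_map_eq_zero]
    intro z hz
    obtain ⟨u, rfl⟩ := TensorProduct.mk_surjective R U K residue_surjective z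
    have h1 : TensorProduct.quotTensorEquivQuotSMul F (maximalIdeal R) (1 ⊗ₜ (u : F)) = 0 := by
      rw [← LinearEquiv.map_zero (TensorProduct.quotTensorEquivQuotSMul F (maximalIdeal R))]
      exact congrArg _ hz
    rw [TensorProduct.quotTensorEquivQuotSMul_mk_one_tmul, Submodule.Quotient.mk_eq_zero] at h1
    have h2 : u ∈ maximalIdeal R • (⊤ : Submodule R U) :=
      (Submodule.mem_smul_top_iff _ _ _).2 (hU.smul_top_inf_le _ ⟨h1, u.2⟩)
    rw [← Submodule.Quotient.mk_eq_zero,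
      ← TensorProduct.quotTensorEquivQuotSMul_mk_one_tmul] at h2
    exact (LinearEquiv.map_eq_zero_iff _).1 h2
  have hexact : Function.Exact (U.subtype.baseChange K) (U.mkQ.baseChange K) :=
    lTensor_exact K (LinearMap.exact_subtype_mkQ U) U.mkQ_surjective
  have hsurj : Function.Surjective (U.mkQ.baseChange K) :=
    LinearMap.lTensor_surjective K U.mkQ_surjective
  have h1 := (U.mkQ.baseChange K).finrank_range_add_finrank_ker
  rw [LinearMap.range_eq_top.2 hsurj, finrank_top, hexact.linearMap_ker_eq,
    LinearMap.finrank_range_of_inj hinj] at h1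
  rw [mu_eq_finrank, mu_eq_finrank, mu_eq_finrank]
  exact Nat.eq_sub_of_add_eq h1
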